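/- arXiv:2210.11336 — 2 statements merged into one kernel-verified Lean document; each statement's English description precedes it below -/
import Mathlib

section
/- With the notation of the sampling theorem, suppose additionally that O is a non-empty subgraph of H with emb(O,G) ≥ 1, and define O-internal vertices of the spanning tree T as vertices v with either v ∈ T∖V(O) and d_v^T ≥ 2, or v ∈ V(O) with an edge uv ∈ T where u ∉ V(O); let i_T^O be their number. For ν an embedding of O into G, let X̄^O(ν) be the number of embeddings σ of H into G restricting to ν on O and with d_{σ(u)} < Δ for all O-internal u. If ν*_1,…,ν*_N are i.i.d. uniform elements of Emb(O,G), X̂^O_N := N^{−1} Σ_i X̄^O(ν*_i), E[D^{h−1}1[D≥Δ]] ≤ λ, and N ≥ (Δ−1)^{2(h−|V(O)|)} ln(2/p) / (2s²), then with probability at least 1 − p: X̂^O_N − s ≤ emb(H,G)/emb(O,G) ≤ X̂^O_N + s + i_T^O λ n / emb(O,G). -/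
open Finset SimpleGraph
open scoped Classical

/-- In a graph, extensions of `ν` along a parent function, each weighted by the probability
that successive uniform choices of neighbours produce it, have total weight at most one. -/
lemma sum_prod_inv_degree_le_one {V W : Type*} [Fintype V] [Fintype W] (G : SimpleGraph W)
    (par : V → V) (rank : V → ℕ) (S : Finset V) (hpar : ∀ v ∉ S, rank (par v) < rank v)
    (ν : V → W) :
    ∑ σ : V → W with (∀ u ∈ S, σ u = ν u) ∧ ∀ u ∉ S, G.Adj (σ (par u)) (σ u),
      ∏ u ∈ Sᶜ, ((G.degree (σ (par u)) : ℝ))⁻¹ ≤ 1 := by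
  induction hm : #Sᶜ generalizing S ν with
  | zero =>
    have hS : ∀ u, u ∈ S := by
      intro u
      have := Finset.card_eq_zero.1 hm
      by_contra hu
      have : u ∈ Sᶜ := by simpa using hu
      simp_all
    have hsub : ({σ : V → W | (∀ u ∈ S, σ u = ν u) ∧ ∀ u ∉ S, G.Adj (σ (par u)) (σ u)} :
        Finset (V → W)) ⊆ {ν} := by
      intro σ hσ
      simp only [mem_filter, mem_univ, true_and] at hσ
      simpa using funext fun u => hσ.1 u (hS u)
    rw [Finset.card_eq_zero.1 hm]
    simp only [prod_empty, sum_const, nsmul_eq_mul, mul_one]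
    exact_mod_cast (card_le_card hsub).trans (by simp)
  | succ m ih =>
    obtain ⟨v, hv, hmin⟩ := exists_min_image Sᶜ rank (card_pos.1 (by omega))
    have hvS : v ∉ S := by simpa using hv
    have hpv : par v ∈ S := by
      by_contra hc
      have := hmin (par v) (by simpa using hc)
      have := hpar v hvS
      omega
    set F : Finset (V → W) :=
      {σ : V → W | (∀ u ∈ S, σ u = ν u) ∧ ∀ u ∉ S, G.Adj (σ (par u)) (σ u)} with hF
    have hmaps : ∀ σ ∈ F, σ v ∈ G.neighborFinset (ν (par v)) := by
      intro σ hσ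
      simp only [hF, mem_filter, mem_univ, true_and] at hσ
      rw [mem_neighborFinset, ← hσ.1 _ hpv]
      exact hσ.2 v hvS
    have hcompl : Sᶜ = insert v (insert v S)ᶜ := by
      ext u
      by_cases h : u = v <;> simp [h, hvS]
    rw [← sum_fiberwise_of_maps_to hmaps]
    calc _ ≤ ∑ y ∈ G.neighborFinset (ν (par v)), ((G.degree (ν (par v)) : ℝ))⁻¹ := by
          refine sum_le_sum fun y _ => ?_
          have hih := ih (insert v S) (fun u hu => hpar u (fun h => hu (mem_insert_of_mem h)))
            (Function.update ν v y) (by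
              have := card_insert_of_notMem (s := (insert v S)ᶜ) (a := v) (by simp)
              rw [← hcompl, hm] at this
              omega)
          calc _ ≤ ∑ σ : V → W with (∀ u ∈ insert v S, σ u = Function.update ν v y u) ∧
                ∀ u ∉ insert v S, G.Adj (σ (par u)) (σ u),
                ((G.degree (ν (par v)) : ℝ))⁻¹ *
                  ∏ u ∈ (insert v S)ᶜ, ((G.degree (σ (par u)) : ℝ))⁻¹ := by
                have hval : ∀ σ ∈ F.filter (fun σ => σ v = y),
                    ∏ u ∈ Sᶜ, ((G.degree (σ (par u)) : ℝ))⁻¹ =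
                    ((G.degree (ν (par v)) : ℝ))⁻¹ *
                    ∏ u ∈ (insert v S)ᶜ, ((G.degree (σ (par u)) : ℝ))⁻¹ := by
                  intro σ hσ
                  simp only [hF, mem_filter, mem_univ, true_and] at hσ
                  rw [hcompl, prod_insert (by simp), hσ.1.1 _ hpv]
                rw [sum_congr rfl hval]
                refine sum_le_sum_of_subset_of_nonneg ?_ fun σ _ _ => by positivity
                intro σ hσ
                simp only [hF, mem_filter, mem_univ, true_and] at hσ ⊢
                refine ⟨fun u hu => ?_, fun u hu => hσ.1.2 u fun h => hu (mem_insert_of_mem h)⟩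
                rcases eq_or_ne u v with rfl | huv
                · simpa using hσ.2
                · rw [Function.update_of_ne huv]
                  exact hσ.1.1 u ((mem_insert.1 hu).resolve_left huv)
            _ ≤ _ := by
                rw [← mul_sum]
                exact mul_le_of_le_one_right (by positivity) hih
      _ ≤ 1 := by
          rw [sum_const, card_neighborFinset_eq_degree, nsmul_eq_mul]
          exact mul_inv_le_one

/-- In a connected graph, every vertex other than `r` has a neighbour closer to `r`. -/
lemma SimpleGraph.Connected.exists_parent {V : Type*} {T : SimpleGraph V} (hT : T.Connected)
    (r : V) : ∃ par : V → V, ∀ v, v ≠ r → T.Adj (par v) v ∧ T.dist (par v) r < T.dist v r := by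
  have : ∀ v, ∃ w, v ≠ r → T.Adj w v ∧ T.dist w r < T.dist v r := by
    intro v
    by_cases hv : v = r
    · exact ⟨v, fun h => absurd hv h⟩
    obtain ⟨p, hp⟩ := hT.exists_walk_length_eq_dist v r
    cases p with
    | nil => exact absurd rfl hv
    | cons hadj q =>
      rename_i w
      refine ⟨w, fun _ => ⟨hadj.symm, ?_⟩⟩
      have := dist_le q
      rw [Walk.length_cons] at hp
      omega
  exact ⟨fun v => (this v).choose, fun v => (this v).choose_spec⟩

/-- The product of `g` over the endpoints of an edge. -/
noncomputable def endpointProd {V : Type*} (g : V → ℝ) : Sym2 V → ℝ :=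
  Sym2.lift ⟨fun a b => g a * g b, fun a b => mul_comm (g a) (g b)⟩

lemma prod_endpointProd_edgeFinset {V : Type*} [Fintype V] {T : SimpleGraph V} (hT : T.IsTree)
    (g : V → ℝ) (r : V) (par : V → V)
    (hpar : ∀ v, v ≠ r → T.Adj (par v) v ∧ T.dist (par v) r < T.dist v r) :
    g r * ∏ e ∈ T.edgeFinset, endpointProd g e =
      (∏ u ∈ {r}ᶜ, g (par u)) * ∏ u, g u := by
  have hinj : Set.InjOn (fun u => s(par u, u)) (({r}ᶜ : Finset V) : Set V) := by
    intro a ha b hb hab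
    have ha' : a ≠ r := by simpa using ha
    have hb' : b ≠ r := by simpa using hb
    rcases Sym2.eq_iff.1 hab with h | h
    · exact h.2
    · have h1 := (hpar a ha').2
      have h2 := (hpar b hb').2
      rw [h.1] at h1
      rw [← h.2] at h2
      omega
  have himage : ({r}ᶜ : Finset V).image (fun u => s(par u, u)) = T.edgeFinset := by
    refine eq_of_subset_of_card_le ?_ ?_
    · intro e he
      obtain ⟨u, hu, rfl⟩ := mem_image.1 he
      simpa using (hpar u (by simpa using hu)).1
    · rw [card_image_of_injOn hinj, card_compl, card_singleton]
      have := hT.card_edgeFinset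
      omega
  rw [← himage, prod_image hinj]
  have : ∏ u, g u = g r * ∏ u ∈ {r}ᶜ, g u := by
    rw [← prod_mul_prod_compl {r}, prod_singleton]
  simp only [endpointProd, Sym2.lift_mk, prod_mul_distrib]
  rw [this]
  ring

/-- A truncated form of the inequality between the arithmetic and geometric means. -/
lemma card_mul_truncated_prod_le {ι : Type*} (U : Finset ι) (y : ι → ℝ) (hy : ∀ u ∈ U, 0 ≤ y u)
    (x D : ℝ) (hD : 0 ≤ D) :
    #U * ((if D ≤ x then 1 else 0) * ∏ u ∈ U, y u) ≤
      ∑ u ∈ U,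
        ((if D ≤ y u then y u ^ #U - D ^ #U else 0) + (if D ≤ x then 1 else 0) * D ^ #U) := by
  have hnonneg : ∀ u ∈ U, 0 ≤ if D ≤ y u then y u ^ #U - D ^ #U else 0 := by
    intro u _
    split_ifs with h
    · exact sub_nonneg.2 (pow_le_pow_left₀ hD h _)
    · exact le_rfl
  by_cases hx : D ≤ x
  · simp only [if_pos hx, one_mul]
    rcases U.eq_empty_or_nonempty with rfl | hU
    · simp
    have hpos : (0 : ℝ) < #U := by exact_mod_cast card_pos.2 hU
    have hamgm := Real.geom_mean_le_arith_mean_weighted U (fun _ => ((#U : ℝ))⁻¹)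
      (fun u => max (y u) D ^ #U) (fun _ _ => by positivity)
      (by rw [sum_const, nsmul_eq_mul, mul_inv_cancel₀ hpos.ne'])
      (fun u _ => pow_nonneg (hD.trans (le_max_right _ _)) _)
    have hroot : ∏ u ∈ U, (max (y u) D ^ #U) ^ ((#U : ℝ))⁻¹ = ∏ u ∈ U, max (y u) D :=
      prod_congr rfl fun u _ => Real.pow_rpow_inv_natCast (hD.trans (le_max_right _ _))
        (card_pos.2 hU).ne'
    rw [hroot, ← mul_sum] at hamgm
    have hprod : ∏ u ∈ U, y u ≤ ∏ u ∈ U, max (y u) D :=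
      prod_le_prod hy fun u _ => le_max_left _ _
    calc _ ≤ #U * (((#U : ℝ))⁻¹ * ∑ u ∈ U, max (y u) D ^ #U) := by
          gcongr
          exact hprod.trans hamgm
      _ = ∑ u ∈ U, max (y u) D ^ #U := by field_simp
      _ = _ := by
          refine sum_congr rfl fun u _ => ?_
          split_ifs with h
          · rw [max_eq_left h]
            ring
          · rw [max_eq_right (not_le.1 h).le]
            ring
  · simpa [if_neg hx] using sum_nonneg hnonneg

/-- The **truncated Sidorenko inequality** for trees. -/
lemma card_tree_hom_le_degree_le {V W : Type*} [Fintype V] [Nontrivial V] [Fintype W]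
    (G : SimpleGraph W) (T : SimpleGraph V) (hT : T.IsTree) (r : V) (Δ : ℕ) :
    (#{σ : V → W | (∀ a b, T.Adj a b → G.Adj (σ a) (σ b)) ∧ Δ ≤ G.degree (σ r)} : ℝ) ≤
      ∑ x, if Δ ≤ G.degree x then (G.degree x : ℝ) ^ (Fintype.card V - 1) else 0 := by
  choose par hpar using fun v => hT.connected.exists_parent v
  obtain ⟨k, hk⟩ : ∃ k, Fintype.card V = k + 2 :=
    ⟨Fintype.card V - 2, by have := Fintype.one_lt_card (α := V); omega⟩
  set homs : Finset (V → W) := {σ : V → W | ∀ a b, T.Adj a b → G.Adj (σ a) (σ b)} with hhoms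
  set d : W → ℝ := fun x => G.degree x with hd
  set q : (V → W) → ℝ := fun σ =>
    (∏ u, d (σ u)) / ∏ e ∈ T.edgeFinset, endpointProd (fun u => d (σ u)) e with hq
  have hdpos : ∀ σ ∈ homs, ∀ u, 0 < d (σ u) := by
    intro σ hσ u
    obtain ⟨w, hw⟩ := hT.connected.preconnected.exists_adj_of_nontrivial u
    have : G.Adj (σ u) (σ w) := (mem_filter.1 hσ).2 u w hw
    simp only [hd, Nat.cast_pos]
    exact (G.degree_pos_iff_exists_adj _).2 ⟨_, this⟩
  have hqv : ∀ σ ∈ homs, ∀ v, q σ = d (σ v) * ∏ u ∈ {v}ᶜ, (d (σ (par v u)))⁻¹ := by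
    intro σ hσ v
    have h := prod_endpointProd_edgeFinset hT (fun u => d (σ u)) v (par v) (hpar v)
    have h1 : 0 < ∏ u ∈ {v}ᶜ, d (σ (par v u)) := prod_pos fun u _ => hdpos σ hσ _
    have h2 : 0 < ∏ u, d (σ u) := prod_pos fun u _ => hdpos σ hσ _
    have h3 := hdpos σ hσ v
    have h4 : 0 < ∏ e ∈ T.edgeFinset, endpointProd (fun u => d (σ u)) e :=
      pos_of_mul_pos_right ((mul_pos h1 h2).trans_eq h.symm) h3.le
    rw [prod_inv_distrib, ← div_eq_mul_inv]
    exact (div_eq_div_iff h4.ne' h1.ne').2 ((mul_comm _ _).trans h.symm)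
  have hmarg : ∀ (v : V) (g : W → ℝ), (∀ x, 0 ≤ g x) →
      ∑ σ ∈ homs, q σ * g (σ v) ≤ ∑ x, d x * g x := by
    intro v g hg
    rw [← sum_fiberwise homs (fun σ => σ v)]
    refine sum_le_sum fun x _ => ?_
    have hone := sum_prod_inv_degree_le_one G (par v) (fun u => T.dist u v) {v}
      (fun u hu => (hpar v u (by simpa using hu)).2) (fun _ => x)
    calc _ = ∑ σ ∈ homs with σ v = x, d x * g x * ∏ u ∈ {v}ᶜ, (d (σ (par v u)))⁻¹ := by
          refine sum_congr rfl fun σ hσ => ?_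
          rw [mem_filter] at hσ
          rw [hqv σ hσ.1 v, hσ.2]
          ring
      _ ≤ d x * g x * 1 := by
          rw [← mul_sum]
          have hdx : 0 ≤ d x := Nat.cast_nonneg _
          refine mul_le_mul_of_nonneg_left (le_trans ?_ hone) (mul_nonneg hdx (hg x))
          refine sum_le_sum_of_subset_of_nonneg (fun σ hσ => ?_) fun σ _ _ =>
            prod_nonneg fun u _ => by positivity
          simp only [hhoms, mem_filter, mem_univ, true_and] at hσ ⊢
          refine ⟨fun u hu => ?_, fun u hu => hσ.1 _ _ (hpar v u (by simpa using hu)).1⟩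
          rw [mem_singleton.1 hu]
          exact hσ.2
      _ = d x * g x := mul_one _
  obtain ⟨c, hc, hcr⟩ : ∃ c, c ≠ r ∧ par r c = r := by
    obtain ⟨c, hc⟩ := hT.connected.preconnected.exists_adj_of_nontrivial r
    refine ⟨c, hc.ne', ?_⟩
    have h1 := (hpar r c hc.ne').2
    rw [dist_comm, dist_eq_one_iff_adj.2 hc.symm, Nat.lt_one_iff] at h1
    exact (hT.connected.dist_eq_zero_iff.1 h1).symm
  set U : Finset V := ({r}ᶜ : Finset V).erase c with hU
  have hUcard : #U = k := by
    rw [hU, card_erase_of_mem (by simpa using hc), card_compl, card_singleton, hk]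
    omega
  have hone : ∀ σ ∈ homs, q σ * ∏ u ∈ U, d (σ (par r u)) = 1 := by
    intro σ hσ
    have hcmem : c ∈ ({r}ᶜ : Finset V) := by simpa using hc
    rw [hqv σ hσ r, ← mul_prod_erase _ _ hcmem, hcr, prod_inv_distrib]
    have h1 : 0 < ∏ u ∈ U, d (σ (par r u)) := prod_pos fun u _ => hdpos σ hσ _
    have h3 := hdpos σ hσ r
    rw [← hU]
    field_simp
  have hqnonneg : ∀ σ ∈ homs, 0 ≤ q σ := by
    intro σ hσ
    rw [hqv σ hσ r]
    exact mul_nonneg (hdpos σ hσ _).le (prod_nonneg fun u _ => inv_nonneg.2 (hdpos σ hσ _).le)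
  set f : W → ℝ := fun x => if (Δ : ℝ) ≤ d x then 1 else 0 with hf
  set φ : W → ℝ := fun x => if (Δ : ℝ) ≤ d x then d x ^ k - (Δ : ℝ) ^ k else 0 with hφ
  have hf0 : ∀ x, 0 ≤ f x := fun x => by simp only [hf]; split_ifs <;> norm_num
  have hφ0 : ∀ x, 0 ≤ φ x := by
    intro x
    simp only [hφ]
    split_ifs with h
    · exact sub_nonneg.2 (pow_le_pow_left₀ (Nat.cast_nonneg _) h _)
    · exact le_rfl
  have hcount : (#{σ : V → W | (∀ a b, T.Adj a b → G.Adj (σ a) (σ b)) ∧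
      Δ ≤ G.degree (σ r)} : ℝ) = ∑ σ ∈ homs, f (σ r) := by
    rw [← filter_filter, ← hhoms, card_filter]
    simp [hf, hd]
  have htarget : ∑ x, (if Δ ≤ G.degree x then (G.degree x : ℝ) ^ (Fintype.card V - 1) else 0) =
      ∑ x, d x * φ x + (Δ : ℝ) ^ k * ∑ x, d x * f x := by
    rw [mul_sum, ← sum_add_distrib]
    refine sum_congr rfl fun x _ => ?_
    have : Fintype.card V - 1 = k + 1 := by omega
    simp only [hφ, hf, hd, Nat.cast_le, this]
    split_ifs <;> ring
  rw [hcount, htarget]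
  rcases Nat.eq_zero_or_pos k with hk0 | hkpos
  · have hU0 : U = ∅ := card_eq_zero.1 (hUcard.trans hk0)
    have hφz : ∀ x, φ x = 0 := fun x => by simp [hφ, hk0]
    simp only [hφz, hk0, mul_zero, sum_const_zero, zero_add, pow_zero, one_mul]
    refine le_trans (sum_le_sum fun σ hσ => ?_) (hmarg r f hf0)
    have := hone σ hσ
    rw [hU0, prod_empty, mul_one] at this
    rw [this, one_mul]
  · have hkR : (0 : ℝ) < k := by exact_mod_cast hkpos
    refine le_of_mul_le_mul_left ?_ hkR
    calc (k : ℝ) * ∑ σ ∈ homs, f (σ r)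
        ≤ ∑ σ ∈ homs, ∑ u ∈ U, (q σ * φ (σ (par r u)) + (Δ : ℝ) ^ k * (q σ * f (σ r))) := by
          rw [mul_sum]
          refine sum_le_sum fun σ hσ => ?_
          have h := card_mul_truncated_prod_le U (fun u => d (σ (par r u)))
            (fun u _ => (hdpos σ hσ _).le) (d (σ r)) Δ (Nat.cast_nonneg _)
          rw [hUcard] at h
          calc (k : ℝ) * f (σ r) = q σ * (k * (f (σ r) * ∏ u ∈ U, d (σ (par r u)))) := by
                linear_combination (-(k : ℝ) * f (σ r)) * hone σ hσ
            _ ≤ q σ * ∑ u ∈ U, (φ (σ (par r u)) + f (σ r) * (Δ : ℝ) ^ k) :=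
                mul_le_mul_of_nonneg_left h (hqnonneg σ hσ)
            _ = _ := by
                rw [mul_sum]
                exact sum_congr rfl fun u _ => by ring
      _ = ∑ u ∈ U, (∑ σ ∈ homs, q σ * φ (σ (par r u)) +
            (Δ : ℝ) ^ k * ∑ σ ∈ homs, q σ * f (σ r)) := by
          rw [sum_comm]
          exact sum_congr rfl fun u _ => by rw [sum_add_distrib, ← mul_sum]
      _ ≤ ∑ u ∈ U, (∑ x, d x * φ x + (Δ : ℝ) ^ k * ∑ x, d x * f x) := by
          refine sum_le_sum fun u _ => add_le_add (hmarg _ φ hφ0) ?_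
          exact mul_le_mul_of_nonneg_left (hmarg r f hf0) (by positivity)
      _ = _ := by rw [sum_const, hUcard, nsmul_eq_mul]

/-- **Hoeffding's lemma** for a uniform element of a finite set. -/
lemma sum_exp_mul_sub_average_le {α : Type*} [Fintype α] (E : Finset α) (hE : E.Nonempty)
    (X : α → ℝ) (b : ℝ) (hX : ∀ a ∈ E, X a ∈ Set.Icc 0 b) (t : ℝ) :
    ∑ a ∈ E, Real.exp (t * (X a - (∑ a ∈ E, X a) / #E)) ≤
      #E * Real.exp (b ^ 2 / 4 * t ^ 2 / 2) := by
  let _ : MeasurableSpace α := ⊤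
  have hint : ∀ f : α → ℝ, ∫ a, f a ∂(PMF.uniformOfFinset E hE).toMeasure =
      (∑ a ∈ E, f a) / #E := by
    intro f
    rw [PMF.integral_eq_sum, ← sum_subset (subset_univ E)]
    · rw [sum_div]
      refine sum_congr rfl fun a ha => ?_
      simp [PMF.uniformOfFinset_apply_of_mem hE ha]
      ring
    · intro a _ ha
      simp [PMF.uniformOfFinset_apply_of_notMem hE ha]
  have hae : ∀ᵐ a ∂(PMF.uniformOfFinset E hE).toMeasure, X a ∈ Set.Icc 0 b := by
    have : (PMF.uniformOfFinset E hE).toMeasure (E : Set α)ᶜ = 0 := by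
      rw [PMF.toMeasure_apply_eq_zero_iff _ (MeasurableSet.of_discrete), PMF.support_uniformOfFinset]
      exact disjoint_compl_right
    refine MeasureTheory.measure_mono_null (fun a ha => ?_) this
    exact fun h => ha (hX a h)
  have h := (ProbabilityTheory.hasSubgaussianMGF_of_mem_Icc
    (Measurable.of_discrete.aemeasurable) hae).mgf_le t
  rw [ProbabilityTheory.mgf, hint, hint] at h
  have hpos : (0 : ℝ) < #E := by exact_mod_cast card_pos.2 hE
  rw [div_le_iff₀ hpos, mul_comm] at h
  refine h.trans_eq ?_
  congr 3
  simp [div_pow]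
  norm_num

/-- The Chernoff bound for independent uniform samples from a finite set. -/
lemma card_filter_le_sum_le {α : Type*} [Fintype α] (E : Finset α) (Y : α → ℝ) (c ε : ℝ)
    (hc : 0 < c) (hε : 0 ≤ ε)
    (hY : ∀ t, ∑ a ∈ E, Real.exp (t * Y a) ≤ #E * Real.exp (c * t ^ 2 / 2)) (N : ℕ) :
    (#{ω ∈ Fintype.piFinset (fun _ : Fin N => E) | N * ε ≤ ∑ i, Y (ω i)} : ℝ) ≤
      (#E : ℝ) ^ N * Real.exp (-(N * ε ^ 2 / (2 * c))) := by
  set t := ε / c with ht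
  have ht0 : 0 ≤ t := by positivity
  have hmarkov : (#{ω ∈ Fintype.piFinset (fun _ : Fin N => E) | N * ε ≤ ∑ i, Y (ω i)} : ℝ) ≤
      ∑ ω ∈ Fintype.piFinset (fun _ : Fin N => E),
        Real.exp (-(t * (N * ε))) * ∏ i, Real.exp (t * Y (ω i)) := by
    rw [card_eq_sum_ones, Nat.cast_sum]
    refine (sum_le_sum fun ω hω => ?_).trans
      (sum_le_sum_of_subset_of_nonneg (filter_subset _ _) fun ω _ _ => by positivity)
    rw [← Real.exp_sum, ← Real.exp_add, Nat.cast_one, ← mul_sum]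
    refine Real.one_le_exp ?_
    have := mul_le_mul_of_nonneg_left (mem_filter.1 hω).2 ht0
    linarith
  have hprod : ∑ ω ∈ Fintype.piFinset (fun _ : Fin N => E), ∏ i, Real.exp (t * Y (ω i)) =
      (∑ a ∈ E, Real.exp (t * Y a)) ^ N := by
    rw [sum_prod_piFinset E fun _ a => Real.exp (t * Y a), prod_const, card_fin]
  rw [← mul_sum, hprod] at hmarkov
  refine hmarkov.trans ?_
  calc _ ≤ Real.exp (-(t * (N * ε))) * (#E * Real.exp (c * t ^ 2 / 2)) ^ N := by
        gcongr
        exact hY t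
    _ = (#E : ℝ) ^ N * Real.exp (-(N * ε ^ 2 / (2 * c))) := by
        rw [mul_pow, ← Real.exp_nat_mul, mul_left_comm, ← Real.exp_add]
        congr 2
        rw [ht]
        field_simp
        ring

/-- **Hoeffding's inequality** for independent uniform samples from a finite set. -/
lemma hoeffding_uniform_samples {α : Type*} [Fintype α] (E : Finset α) (hE : E.Nonempty)
    (X : α → ℝ) (b : ℝ) (hX : ∀ a ∈ E, X a ∈ Set.Icc 0 b) (s p : ℝ) (hs : 0 < s) (hp0 : 0 < p)
    (hp1 : p ≤ 1) (N : ℕ) (hN : b ^ 2 * Real.log (2 / p) / (2 * s ^ 2) ≤ N) :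
    (1 - p) * (#E : ℝ) ^ N ≤
      #{ω ∈ Fintype.piFinset (fun _ : Fin N => E) |
        |(∑ i, X (ω i)) / N - (∑ a ∈ E, X a) / #E| ≤ s} := by
  have hcardpi : #(Fintype.piFinset (fun _ : Fin N => E)) = #E ^ N := by simp
  set μ := (∑ a ∈ E, X a) / #E with hμ
  obtain ⟨a₀, ha₀⟩ := hE
  have hb : 0 ≤ b := (hX a₀ ha₀).1.trans (hX a₀ ha₀).2
  rcases hb.eq_or_lt with rfl | hb
  · have hX0 : ∀ a ∈ E, X a = 0 := fun a ha => le_antisymm (hX a ha).2 (hX a ha).1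
    have hμ0 : μ = 0 := by rw [hμ, sum_eq_zero hX0, zero_div]
    rw [filter_true_of_mem, hcardpi]
    · push_cast
      exact mul_le_of_le_one_left (by positivity) (by linarith)
    · intro ω hω
      rw [sum_eq_zero fun i _ => hX0 _ (Fintype.mem_piFinset.1 hω i), hμ0]
      simpa using hs.le
  have hlog : 0 < Real.log (2 / p) := Real.log_pos (by rw [lt_div_iff₀ hp0]; linarith)
  have hNpos : (0 : ℝ) < N := lt_of_lt_of_le (by positivity) hN
  have hexp : Real.exp (-(N * s ^ 2 / (2 * (b ^ 2 / 4)))) ≤ p / 2 := by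
    rw [← Real.exp_log (show 0 < p / 2 by positivity)]
    refine Real.exp_le_exp.2 ?_
    rw [← inv_div 2 p, Real.log_inv, neg_le_neg_iff, le_div_iff₀ (by positivity)]
    rw [div_le_iff₀ (by positivity)] at hN
    linarith
  have hmgf := sum_exp_mul_sub_average_le E ⟨a₀, ha₀⟩ X b hX
  rw [← hμ] at hmgf
  have h1 := card_filter_le_sum_le E (fun a => X a - μ) (b ^ 2 / 4) s (by positivity) hs.le hmgf N
  have h2 := card_filter_le_sum_le E (fun a => -(X a - μ)) (b ^ 2 / 4) s (by positivity) hs.le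
    (fun t => by simpa only [neg_mul_comm, neg_sq] using hmgf (-t)) N
  have hcover : Fintype.piFinset (fun _ : Fin N => E) ⊆
      {ω ∈ Fintype.piFinset (fun _ : Fin N => E) | |(∑ i, X (ω i)) / N - μ| ≤ s} ∪
      ({ω ∈ Fintype.piFinset (fun _ : Fin N => E) | N * s ≤ ∑ i, (X (ω i) - μ)} ∪
      {ω ∈ Fintype.piFinset (fun _ : Fin N => E) | N * s ≤ ∑ i, -(X (ω i) - μ)}) := by
    intro ω hω
    simp only [mem_union, mem_filter, hω, true_and]
    by_contra! hcon
    obtain ⟨h₀, h₁, h₂⟩ := hcon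
    have hsum : ∑ i : Fin N, (X (ω i) - μ) = N * ((∑ i, X (ω i)) / N - μ) := by
      rw [sum_sub_distrib]
      simp
      field_simp
    rw [sum_neg_distrib] at h₂
    rw [hsum] at h₁ h₂
    rw [← mul_neg] at h₂
    have h₁ := lt_of_mul_lt_mul_left h₁ hNpos.le
    have h₂ := lt_of_mul_lt_mul_left h₂ hNpos.le
    exact absurd (abs_le.2 ⟨by linarith, h₁.le⟩) (not_le.2 h₀)
  have hcard := (card_le_card hcover).trans
    ((card_union_le _ _).trans (Nat.add_le_add_left (card_union_le _ _) _))
  rw [hcardpi] at hcard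
  have hcardR := (Nat.cast_le (α := ℝ)).2 hcard
  push_cast at hcardR
  have hmul := mul_le_mul_of_nonneg_left hexp (show 0 ≤ (#E : ℝ) ^ N by positivity)
  linarith

/-- Extensions of `ν` along a parent function whose parents are mapped to vertices of degree at
most `D` number at most `D ^ #Sᶜ`. -/
lemma card_extensions_le_pow {V W : Type*} [Fintype V] [Fintype W] (G : SimpleGraph W)
    (par : V → V) (rank : V → ℕ) (S : Finset V) (hpar : ∀ v ∉ S, rank (par v) < rank v)
    (ν : V → W) (D : ℕ) :
    (#{σ : V → W | (∀ u ∈ S, σ u = ν u) ∧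
      ∀ u ∉ S, G.Adj (σ (par u)) (σ u) ∧ G.degree (σ (par u)) ≤ D} : ℝ) ≤ (D : ℝ) ^ #Sᶜ := by
  rw [card_eq_sum_ones, Nat.cast_sum]
  calc _ ≤ ∑ σ : V → W with (∀ u ∈ S, σ u = ν u) ∧
        ∀ u ∉ S, G.Adj (σ (par u)) (σ u) ∧ G.degree (σ (par u)) ≤ D,
        (D : ℝ) ^ #Sᶜ * ∏ u ∈ Sᶜ, ((G.degree (σ (par u)) : ℝ))⁻¹ := by
        refine sum_le_sum fun σ hσ => ?_
        simp only [mem_filter, mem_univ, true_and] at hσ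
        rw [← prod_const, ← prod_mul_distrib, Nat.cast_one]
        refine prod_induction _ (fun x : ℝ => 1 ≤ x)
          (fun _ _ => one_le_mul_of_one_le_of_one_le) le_rfl fun u hu => ?_
        obtain ⟨hadj, hdeg⟩ := hσ.2 u (by simpa using hu)
        have hpos : 0 < G.degree (σ (par u)) := (G.degree_pos_iff_exists_adj _).2 ⟨_, hadj⟩
        rw [← div_eq_mul_inv, one_le_div (by exact_mod_cast hpos)]
        exact_mod_cast hdeg
    _ ≤ ∑ σ : V → W with (∀ u ∈ S, σ u = ν u) ∧ ∀ u ∉ S, G.Adj (σ (par u)) (σ u),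
        (D : ℝ) ^ #Sᶜ * ∏ u ∈ Sᶜ, ((G.degree (σ (par u)) : ℝ))⁻¹ := by
        refine sum_le_sum_of_subset_of_nonneg (fun σ hσ => ?_) fun σ _ _ => by positivity
        simp only [mem_filter, mem_univ, true_and] at hσ ⊢
        exact ⟨hσ.1, fun u hu => (hσ.2 u hu).1⟩
    _ ≤ (D : ℝ) ^ #Sᶜ := by
        rw [← mul_sum]
        exact mul_le_of_le_one_right (by positivity)
          (sum_prod_inv_degree_le_one G par rank S hpar ν)

/-- Sampling theorem with a subgraph `O` (Theorem 3.3 of the paper): sampling `N`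
i.i.d. uniform embeddings `ν*_1, …, ν*_N` of a non-empty subgraph `O ⊆ H` into `G`
(modelled by counting fractions with denominator `emb(O,G)^N`), if
`E[D^(h-1) 1[D ≥ Δ]] ≤ λ` and `N ≥ (Δ-1)^(2(h-|V(O)|)) ln(2/p)/(2s²)`, then with
probability at least `1 - p`,
`X̂^O_N - s ≤ emb(H,G)/emb(O,G) ≤ X̂^O_N + s + i_T^O λ n / emb(O,G)`. -/
theorem subgraph_sampling_hoeffding
    {VH VG : Type*} [Fintype VH] [Fintype VG]
    (H : SimpleGraph VH) (G : SimpleGraph VG)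
    (h n : ℕ) (hcard : Fintype.card VH = h) (hn : Fintype.card VG = n)
    (hn1 : 1 ≤ n) (hconn : H.Connected)
    (T : SimpleGraph VH) (hTle : T ≤ H) (hTtree : T.IsTree)
    (S : Finset VH) (hS : S.Nonempty)
    (O : SimpleGraph VH) (hOle : O ≤ H)
    (hOsupp : ∀ u v, O.Adj u v → u ∈ S ∧ v ∈ S)
    (Δ : ℕ) (hΔ : 0 < Δ) (lam : ℝ) (hlam : 0 ≤ lam)
    (hexp : (∑ v : VG, if Δ ≤ G.degree v then (G.degree v : ℝ) ^ (h - 1) else 0) / n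
              ≤ lam)
    (EmbO : Finset (S → VG))
    (hEmbO : EmbO = Finset.univ.filter
      (fun ν : S → VG =>
        (∀ u v : S, O.Adj u v → G.Adj (ν u) (ν v)) ∧ Function.Injective ν))
    (hEmbO1 : 1 ≤ EmbO.card)
    (XO : (S → VG) → ℕ)
    (hXO : ∀ ν, XO ν = (Finset.univ.filter
      (fun σ : VH → VG =>
        (∀ a b, H.Adj a b → G.Adj (σ a) (σ b)) ∧ Function.Injective σ ∧
        (∀ u : S, σ u = ν u) ∧
        ∀ u : VH,
          ((u ∉ S ∧ 2 ≤ T.degree u) ∨ (u ∈ S ∧ ∃ w, T.Adj u w ∧ w ∉ S)) →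
            G.degree (σ u) < Δ)).card)
    (iTO : ℕ)
    (hiTO : iTO = (Finset.univ.filter
      (fun u : VH =>
        (u ∉ S ∧ 2 ≤ T.degree u) ∨ (u ∈ S ∧ ∃ w, T.Adj u w ∧ w ∉ S))).card)
    (emb : ℕ)
    (hemb : emb = (Finset.univ.filter
      (fun σ : VH → VG =>
        (∀ a b, H.Adj a b → G.Adj (σ a) (σ b)) ∧ Function.Injective σ)).card)
    (s p : ℝ) (hs : 0 < s) (hp0 : 0 < p) (hp1 : p ≤ 1)
    (N : ℕ)
    (hN : ((Δ - 1 : ℕ) : ℝ) ^ (2 * (h - S.card)) * Real.log (2 / p) / (2 * s ^ 2)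
            ≤ (N : ℝ)) :
    (1 - p) * (EmbO.card : ℝ) ^ N ≤
      ((Finset.univ.filter
        (fun ω : Fin N → (S → VG) =>
          (∀ i, ω i ∈ EmbO) ∧
          (∑ i : Fin N, (XO (ω i) : ℝ)) / N - s ≤ (emb : ℝ) / EmbO.card ∧
          (emb : ℝ) / EmbO.card ≤
            (∑ i : Fin N, (XO (ω i) : ℝ)) / N + s + iTO * lam * n / EmbO.card)).card
        : ℝ) := by
  obtain ⟨r, hr⟩ := hS
  obtain ⟨par, hpar⟩ := hTtree.connected.exists_parent r
  set internal : VH → Prop := fun u =>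
    (u ∉ S ∧ 2 ≤ T.degree u) ∨ (u ∈ S ∧ ∃ w, T.Adj u w ∧ w ∉ S) with hint
  have hne : ∀ v ∉ S, v ≠ r := fun v hv h => hv (h ▸ hr)
  have hparint : ∀ v ∉ S, internal (par v) := by
    intro v hv
    have hpv := hpar v (hne v hv)
    by_cases hp : par v ∈ S
    · exact Or.inr ⟨hp, v, hpv.1, hv⟩
    · refine Or.inl ⟨hp, ?_⟩
      have hppv := hpar _ (hne _ hp)
      have hneq : par (par v) ≠ v := by
        intro h
        rw [h] at hppv
        exact lt_asymm hppv.2 hpv.2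
      rw [← card_neighborFinset_eq_degree, ← card_pair hneq]
      refine card_le_card fun w hw => ?_
      rw [mem_neighborFinset]
      rcases mem_insert.1 hw with rfl | hw
      · exact hppv.1.symm
      · rw [mem_singleton.1 hw]
        exact hpv.1
  have hXle : ∀ ν, (XO ν : ℝ) ≤ ((Δ - 1 : ℕ) : ℝ) ^ (h - #S) := by
    intro ν
    rw [← hcard, ← card_compl, hXO]
    refine le_trans (Nat.cast_le.2 (card_le_card fun σ hσ => ?_))
      (card_extensions_le_pow G par (fun v => T.dist v r) S (fun v hv => (hpar v (hne v hv)).2)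
        (fun v => if hv : v ∈ S then ν ⟨v, hv⟩ else ν ⟨r, hr⟩) (Δ - 1))
    simp only [mem_filter, mem_univ, true_and] at hσ ⊢
    obtain ⟨hhom, -, hres, hdeg⟩ := hσ
    refine ⟨fun u hu => ?_, fun u hu => ⟨hhom _ _ (hTle (hpar u (hne u hu)).1), ?_⟩⟩
    · rw [dif_pos hu]
      exact hres ⟨u, hu⟩
    · exact Nat.le_sub_one_of_lt (hdeg _ (hparint u hu))
  set A : Finset (VH → VG) := Finset.univ.filter
    (fun σ : VH → VG => (∀ a b, H.Adj a b → G.Adj (σ a) (σ b)) ∧ Function.Injective σ) with hA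
  set good : (VH → VG) → Prop := fun σ => ∀ u, internal u → G.degree (σ u) < Δ with hgood
  have hsum : ∑ ν ∈ EmbO, XO ν = #(A.filter good) := by
    have hmaps : ∀ σ ∈ A.filter good, (fun u : S => σ u) ∈ EmbO := by
      intro σ hσ
      simp only [hA, hEmbO, mem_filter, mem_univ, true_and] at hσ ⊢
      exact ⟨fun u v huv => hσ.1.1 _ _ (hOle huv), hσ.1.2.comp Subtype.val_injective⟩
    rw [card_eq_sum_card_fiberwise hmaps]
    refine sum_congr rfl fun ν _ => ?_
    rw [hXO]
    congr 1
    ext σ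
    simp only [hA, mem_filter, mem_univ, true_and, funext_iff, hgood]
    tauto
  have hbad : (#(A.filter fun σ => ¬ good σ) : ℝ) ≤ iTO * (lam * n) := by
    have hnpos : (0 : ℝ) < n := by exact_mod_cast hn1
    rw [div_le_iff₀ hnpos, ← hcard] at hexp
    have hsub : (A.filter fun σ => ¬ good σ) ⊆ (Finset.univ.filter internal).biUnion fun u =>
        {σ : VH → VG | (∀ a b, T.Adj a b → G.Adj (σ a) (σ b)) ∧ Δ ≤ G.degree (σ u)} := by
      intro σ hσ
      simp only [hA, hgood, mem_filter, mem_univ, true_and, not_forall, not_lt, mem_biUnion]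
        at hσ ⊢
      obtain ⟨⟨hhom, -⟩, u, hu, hdeg⟩ := hσ
      exact ⟨u, hu, fun a b hab => hhom a b (hTle hab), hdeg⟩
    have hcardle := (Nat.cast_le (α := ℝ)).2 ((card_le_card hsub).trans card_biUnion_le)
    rw [Nat.cast_sum] at hcardle
    refine hcardle.trans ((sum_le_card_nsmul _ _ (lam * n) fun u hu => ?_).trans_eq ?_)
    · have : Nontrivial VH := by
        rcases (mem_filter.1 hu).2 with ⟨hu, -⟩ | ⟨-, w, hw, -⟩
        · exact ⟨u, r, hne u hu⟩
        · exact ⟨u, w, hw.ne⟩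
      exact (card_tree_hom_le_degree_le G T hTtree u Δ).trans hexp
    · rw [nsmul_eq_mul, hiTO]
  have hsplit : emb = #(A.filter good) + #(A.filter fun σ => ¬ good σ) := by
    rw [hemb, card_filter_add_card_filter_not]
  have hEpos : (0 : ℝ) < #EmbO := by exact_mod_cast hEmbO1
  have hlower : (∑ ν ∈ EmbO, (XO ν : ℝ)) / #EmbO ≤ (emb : ℝ) / #EmbO := by
    gcongr
    rw [hsplit, ← hsum]
    push_cast
    exact le_add_of_nonneg_right (Nat.cast_nonneg _)
  have hupper : (emb : ℝ) / #EmbO ≤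
      (∑ ν ∈ EmbO, (XO ν : ℝ)) / #EmbO + iTO * lam * n / #EmbO := by
    rw [← add_div]
    gcongr
    rw [hsplit, ← hsum]
    push_cast
    linarith
  have hhoeff := hoeffding_uniform_samples EmbO (card_pos.1 hEmbO1) (fun ν => (XO ν : ℝ))
    (((Δ - 1 : ℕ) : ℝ) ^ (h - #S)) (fun ν _ => ⟨Nat.cast_nonneg _, hXle ν⟩) s p hs hp0 hp1 N
    (by rwa [← pow_mul, mul_comm (h - #S)])
  refine hhoeff.trans (Nat.cast_le.2 (card_le_card fun ω hω => ?_))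
  simp only [mem_filter, mem_univ, true_and, Fintype.mem_piFinset, abs_le] at hω ⊢
  exact ⟨hω.1, by linarith [hω.2.2], by linarith [hω.2.1]⟩
end

section
/- Let O be a non-empty subgraph of a connected graph H on h vertices, T a spanning tree of H, and G a graph on n vertices with emb(O,G) ≥ 1. Then emb(O,G) · E[X̄^O(ν*)] ≤ emb(H,G) ≤ emb(O,G) · E[X̄^O(ν*)] + i_T^O λ n, where ν* is a uniformly random embedding of O into G, X̄^O(ν) counts embeddings of H extending ν with all O-internal vertices of T mapped to vertices of degree < Δ, i_T^O is the number of O-internal vertices of T, and λ ≥ E[D^{h−1} 1[D ≥ Δ]] for D the degree of a uniform random vertex of G. -/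
open Finset SimpleGraph
open scoped Classical

/-- The weight of a map `σ` of the vertices of `T` into `G`: up to normalisation, the probability
that the stationary random walk on `G` indexed by the tree `T` equals `σ`. -/
noncomputable def treeWalkWeight {V W : Type*} [Fintype V] [Fintype W] (T : SimpleGraph V)
    (G : SimpleGraph W) (σ : V → W) : ℝ :=
  (if ∀ a b, T.Adj a b → G.Adj (σ a) (σ b) then 1 else 0) *
    ∏ y, (G.degree (σ y) : ℝ) / (G.degree (σ y) : ℝ) ^ T.degree y

theorem treeWalkWeight_nonneg {V W : Type*} [Fintype V] [Fintype W] (T : SimpleGraph V)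
    (G : SimpleGraph W) (σ : V → W) : 0 ≤ treeWalkWeight T G σ := by
  unfold treeWalkWeight
  split_ifs <;> positivity

theorem degree_eq_sum_ite {V : Type*} [Fintype V] (T : SimpleGraph V) (v : V) :
    T.degree v = ∑ z, if T.Adj v z then 1 else 0 := by
  rw [← SimpleGraph.card_neighborFinset_eq_degree, SimpleGraph.neighborFinset_eq_filter]
  simp

theorem degree_eq_degree_add_of_adj_iff {V : Type*} [Fintype V] (T : SimpleGraph V) {l : V}
    (T' : SimpleGraph {y // y ≠ l}) (hT' : ∀ a b, T'.Adj a b ↔ T.Adj a b) (y : {y // y ≠ l}) :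
    T.degree y = T'.degree y + if T.Adj y l then 1 else 0 := by
  rw [degree_eq_sum_ite, degree_eq_sum_ite, Fintype.sum_eq_add_sum_subtype_ne _ l, add_comm]
  simp only [hT']

theorem treeWalkWeight_funSplitAt {V W : Type*} [Fintype V] [Fintype W] (T : SimpleGraph V)
    (G : SimpleGraph W) {l : V} {p : {y // y ≠ l}} (hlp : ∀ z, T.Adj l z ↔ z = p)
    (T' : SimpleGraph {y // y ≠ l})
    (hT' : ∀ a b, T'.Adj a b ↔ T.Adj a b) (w : W) (τ : {y // y ≠ l} → W) :
    treeWalkWeight T G ((Equiv.funSplitAt l W).symm (w, τ)) =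
      (if G.Adj (τ p) w then 1 else 0) *
        (treeWalkWeight T' G τ * (G.degree (τ p) : ℝ)⁻¹) := by
  set σ := (Equiv.funSplitAt l W).symm (w, τ) with hσ
  have hl : σ l = w := by simp [hσ, Equiv.funSplitAt, Equiv.piSplitAt]
  have hne : ∀ y : {y // y ≠ l}, σ y = τ y := by
    intro y
    simp [hσ, Equiv.funSplitAt, Equiv.piSplitAt, y.2]
  have hdl : T.degree l = 1 := by
    rw [SimpleGraph.degree_eq_one_iff_existsUnique_adj]
    exact ⟨p, (hlp _).2 rfl, fun z hz => (hlp z).1 hz⟩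
  have hadj : ∀ y : {y // y ≠ l}, T.Adj y l ↔ y = p := by
    intro y
    rw [T.adj_comm, hlp, Subtype.ext_iff]
  have hhom : (∀ a b, T.Adj a b → G.Adj (σ a) (σ b)) ↔
      G.Adj (τ p) w ∧ ∀ a b, T'.Adj a b →
        G.Adj (τ a) (τ b) := by
    constructor
    · intro hom
      refine ⟨?_, fun a b hab => ?_⟩
      · have := hom p l ((hadj p).2 rfl)
        rwa [hne, hl] at this
      · have := hom a b ((hT' a b).1 hab)
        rwa [hne, hne] at this
    · rintro ⟨hp, hom⟩ a b hab
      by_cases ha : a = l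
      · subst ha
        rw [(hlp b).1 hab, hl, hne]
        exact hp.symm
      · by_cases hb : b = l
        · subst hb
          rw [(hlp a).1 hab.symm, hl, hne]
          exact hp
        · have := hom ⟨a, ha⟩ ⟨b, hb⟩ ((hT' _ _).2 hab)
          rwa [← hne, ← hne] at this
  have hprod : ∏ y : {y // y ≠ l}, (G.degree (σ y) : ℝ) / (G.degree (σ y) : ℝ) ^ T.degree y =
      (∏ y, (G.degree (τ y) : ℝ) / (G.degree (τ y) : ℝ) ^ T'.degree y) * (G.degree (τ p) : ℝ)⁻¹ := by
    have : (G.degree (τ p) : ℝ)⁻¹ =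
        ∏ y, if y = p then (G.degree (τ y) : ℝ)⁻¹ else 1 := by simp
    rw [this, ← Finset.prod_mul_distrib]
    refine Finset.prod_congr rfl fun y _ => ?_
    rw [hne, degree_eq_degree_add_of_adj_iff T T' hT', pow_add]
    by_cases hy : y = p
    · rw [if_pos ((hadj y).2 hy), if_pos hy, pow_one]
      rw [div_mul_eq_div_div, div_eq_mul_inv _ (G.degree (τ y) : ℝ)]
    · rw [if_neg (mt (hadj y).1 hy), if_neg hy]
      simp
  unfold treeWalkWeight
  rw [Fintype.prod_eq_mul_prod_subtype_ne _ l, hprod, hl, hdl, pow_one]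
  by_cases hp : G.Adj (τ p) w
  · have hw : (G.degree w : ℝ) ≠ 0 := by
      have := (G.degree_pos_iff_exists_adj w).2 ⟨_, hp.symm⟩
      positivity
    simp only [hhom, hp, true_and, if_true, div_self hw]
    ring
  · simp [hhom, hp]

/-- The marginals of the stationary tree-indexed walk are stationary. -/
theorem sum_treeWalkWeight_mul {W : Type*} [Fintype W] (G : SimpleGraph W) (f : W → ℝ) (k : ℕ) :
    ∀ {V : Type*} [Fintype V] (T : SimpleGraph V), T.IsTree → Fintype.card V = k → ∀ x : V,
      ∑ σ : V → W, treeWalkWeight T G σ * f (σ x) = ∑ v, (G.degree v : ℝ) * f v := by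
  induction k with
  | zero =>
    intro V _ T _ hc x
    exact absurd hc (Fintype.card_pos_iff.2 ⟨x⟩).ne'
  | succ k ih =>
    intro V _ T hT hc x
    rcases subsingleton_or_nontrivial V with hs | hs
    · have : Unique V := ⟨⟨x⟩, fun _ => Subsingleton.elim _ _⟩
      rw [← (Equiv.funUnique V W).symm.sum_comp]
      refine Finset.sum_congr rfl fun v _ => ?_
      have hno : ∀ a b, ¬ T.Adj a b := fun a b hab => hab.ne (Subsingleton.elim _ _)
      have hv : (Equiv.funUnique V W).symm v = fun _ => v := rfl
      rw [hv]
      simp [treeWalkWeight, hno]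
    · obtain ⟨l, hlx, hl⟩ : ∃ l, l ≠ x ∧ T.degree l = 1 := by
        obtain ⟨a, b, hab, ha, hb⟩ := hT.exists_ne_and_degree_eq_one
        by_cases hax : a = x
        · exact ⟨b, hax ▸ hab.symm, hb⟩
        · exact ⟨a, hax, ha⟩
      obtain ⟨p, hp, hpu⟩ := SimpleGraph.degree_eq_one_iff_existsUnique_adj.1 hl
      have hpl : p ≠ l := hp.ne'
      have hlp : ∀ z, T.Adj l z ↔ z = (⟨p, hpl⟩ : {y // y ≠ l}) :=
        fun z => ⟨fun hz => hpu z hz, fun hz => hz ▸ hp⟩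
      have hT' : (T.comap (Subtype.val : {y // y ≠ l} → V)).IsTree :=
        ⟨hT.connected.induce_compl_singleton_of_degree_eq_one hl, hT.isAcyclic.induce {l}ᶜ⟩
      have hc' : Fintype.card {y // y ≠ l} = k := by
        rw [Fintype.card_subtype_compl]
        simp [hc]
      rw [← ih _ hT' hc' ⟨x, hlx.symm⟩, ← (Equiv.funSplitAt l W).symm.sum_comp,
        Fintype.sum_prod_type_right]
      refine Finset.sum_congr (by ext; simp) fun τ _ => ?_
      have hx : ∀ w, (Equiv.funSplitAt l W).symm (w, τ) x = τ ⟨x, hlx.symm⟩ := fun w => by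
        simp [Equiv.funSplitAt, Equiv.piSplitAt, hlx.symm]
      simp only [hx, treeWalkWeight_funSplitAt T G hlp
        (T.comap (Subtype.val : {y // y ≠ l} → V)) (fun _ _ => Iff.rfl)]
      rw [← Finset.sum_mul, ← Finset.sum_mul]
      congr 1
      have hdeg : (∑ w, if G.Adj (τ ⟨p, hpl⟩) w then (1 : ℝ) else 0) =
          G.degree (τ ⟨p, hpl⟩) := by
        rw [degree_eq_sum_ite]
        push_cast
        rfl
      rw [hdeg]
      by_cases h0 : (G.degree (τ ⟨p, hpl⟩) : ℝ) = 0
      · rw [h0, zero_mul]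
        symm
        unfold treeWalkWeight
        rw [Finset.prod_eq_zero (mem_univ ⟨p, hpl⟩) (by rw [h0, zero_div]), mul_zero]
      · field_simp

/-- A weighted mean of powers bounds a product of powers of total exponent `∑ a`. -/
theorem prod_pow_le_sum_mul_pow {V : Type*} [Fintype V] (a : V → ℕ) (z : V → ℝ)
    (hz : ∀ y, 0 ≤ z y) (ha : 0 < ∑ y, a y) :
    ∏ y, z y ^ a y ≤ ∑ y, (a y : ℝ) / (∑ y, a y : ℕ) * z y ^ (∑ y, a y) := by
  set A := ∑ y, a y with hA
  have hA0 : (A : ℝ) ≠ 0 := by positivity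
  have := Real.geom_mean_le_arith_mean_weighted univ (fun y => (a y : ℝ) / A)
    (fun y => z y ^ A) (fun y _ => by positivity)
    (by rw [← Finset.sum_div, hA]; push_cast; rw [div_self]; rw [hA] at hA0; exact_mod_cast hA0)
    (fun y _ => pow_nonneg (hz y) _)
  refine le_trans (le_of_eq (Finset.prod_congr rfl fun y _ => ?_)) this
  rw [← Real.rpow_natCast (z y) A, ← Real.rpow_mul (hz y), mul_div_cancel₀ _ hA0,
    Real.rpow_natCast]

/-- Multiplying the weight by powers of the degrees recovers the indicator of homomorphisms. -/
theorem treeWalkWeight_mul_prod {V W : Type*} [Fintype V] [Fintype W] {T : SimpleGraph V}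
    (G : SimpleGraph W) (hT : ∀ y, 0 < T.degree y) (σ : V → W) :
    treeWalkWeight T G σ * ∏ y, (G.degree (σ y) : ℝ) ^ (T.degree y - 1) =
      if ∀ a b, T.Adj a b → G.Adj (σ a) (σ b) then 1 else 0 := by
  unfold treeWalkWeight
  split_ifs with hom
  · rw [one_mul, ← Finset.prod_mul_distrib]
    refine Finset.prod_eq_one fun y _ => ?_
    obtain ⟨z, hz⟩ := (T.degree_pos_iff_exists_adj y).1 (hT y)
    have hpos := (G.degree_pos_iff_exists_adj (σ y)).2 ⟨_, hom _ _ hz⟩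
    have hne : (G.degree (σ y) : ℝ) ≠ 0 := by positivity
    obtain ⟨m, hm⟩ := Nat.exists_eq_add_of_lt (hT y)
    rw [hm]
    simp only [zero_add, Nat.add_sub_cancel]
    field_simp
    ring
  · simp

/-- The truncated homomorphism inequality for trees: `hom_Δ(T, G) ≤ ∑ d_v ^ (h - 1) 1[d_v ≥ Δ]`,
where the root `u` may be any vertex. -/
theorem card_tree_hom_truncated_le {V W : Type*} [Fintype V] [Fintype W] {T : SimpleGraph V}
    (hT : T.IsTree) (hV : 2 ≤ Fintype.card V) (G : SimpleGraph W) (Δ : ℕ) (u : V) :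
    ((univ.filter fun σ : V → W =>
      (∀ a b, T.Adj a b → G.Adj (σ a) (σ b)) ∧ Δ ≤ G.degree (σ u)).card : ℝ) ≤
      ∑ v, if Δ ≤ G.degree v then (G.degree v : ℝ) ^ (Fintype.card V - 1) else 0 := by
  have : Nontrivial V := Fintype.one_lt_card_iff_nontrivial.1 hV
  have hdeg : ∀ y, 0 < T.degree y := fun y => hT.connected.preconnected.degree_pos_of_nontrivial y
  set A := ∑ y, (T.degree y - 1) with hA
  have hA2 : A + 1 = Fintype.card V - 1 := by
    have h1 := T.sum_degrees_eq_twice_card_edges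
    have h2 := hT.card_edgeFinset
    have h3 : ∑ y, T.degree y = A + Fintype.card V := by
      rw [hA, Fintype.card_eq_sum_ones, ← Finset.sum_add_distrib]
      exact Finset.sum_congr rfl fun y _ => by have := hdeg y; omega
    omega
  set d : W → ℝ := fun v => G.degree v with hd
  set I : W → ℝ := fun v => if Δ ≤ G.degree v then 1 else 0 with hI
  have hI0 : ∀ v, 0 ≤ I v := fun v => by simp only [hI]; split_ifs <;> norm_num
  have hmarg : ∀ (f : W → ℝ) (x : V),
      ∑ σ : V → W, treeWalkWeight T G σ * f (σ x) = ∑ v, d v * f v :=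
    fun f x => sum_treeWalkWeight_mul G f _ T hT rfl x
  have hrhs : (∑ v, if Δ ≤ G.degree v then (G.degree v : ℝ) ^ (Fintype.card V - 1) else 0) =
      ∑ v, d v * (I v * d v ^ A) := by
    refine Finset.sum_congr rfl fun v _ => ?_
    rw [← hA2, pow_succ']
    simp only [hI, hd]
    split_ifs <;> simp
  have hlhs : ((univ.filter fun σ : V → W =>
      (∀ a b, T.Adj a b → G.Adj (σ a) (σ b)) ∧ Δ ≤ G.degree (σ u)).card : ℝ) =
      ∑ σ : V → W, treeWalkWeight T G σ * (I (σ u) * ∏ y, d (σ y) ^ (T.degree y - 1)) := by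
    rw [Finset.card_filter]
    push_cast
    refine Finset.sum_congr rfl fun σ _ => ?_
    rw [mul_left_comm, treeWalkWeight_mul_prod G hdeg]
    simp only [hI]
    split_ifs <;> simp_all
  rw [hrhs, hlhs]
  have hswap : ∀ y, ∑ σ : V → W, treeWalkWeight T G σ * (I (σ u) * d (σ y) ^ A) ≤
      ∑ v, d v * (I v * d v ^ A) := by
    intro y
    have hpt : ∀ a b : W, I a * d b ^ A ≤ I b * d b ^ A + (Δ : ℝ) ^ A * (I a - I b) := by
      intro a b
      simp only [hI, hd]
      split_ifs with ha hb hb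
      · simp
      · have : (G.degree b : ℝ) ^ A ≤ (Δ : ℝ) ^ A := by
          gcongr
          exact_mod_cast (not_le.1 hb).le
        linarith
      · have : (Δ : ℝ) ^ A ≤ (G.degree b : ℝ) ^ A := by gcongr
        linarith
      · simp
    calc ∑ σ : V → W, treeWalkWeight T G σ * (I (σ u) * d (σ y) ^ A)
        ≤ ∑ σ : V → W, (treeWalkWeight T G σ * (I (σ y) * d (σ y) ^ A) +
            (Δ : ℝ) ^ A * (treeWalkWeight T G σ * I (σ u) - treeWalkWeight T G σ * I (σ y))) := by
          refine Finset.sum_le_sum fun σ _ => ?_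
          have := mul_le_mul_of_nonneg_left (hpt (σ u) (σ y)) (treeWalkWeight_nonneg T G σ)
          linarith
      _ = ∑ v, d v * (I v * d v ^ A) := by
          rw [Finset.sum_add_distrib, ← Finset.mul_sum, Finset.sum_sub_distrib, hmarg, hmarg,
            hmarg (fun v => I v * d v ^ A), sub_self, mul_zero, add_zero]
  rcases Nat.eq_zero_or_pos A with h0 | h0
  · have hz : ∀ y, T.degree y - 1 = 0 := by
      intro y
      rw [hA] at h0
      exact Finset.sum_eq_zero_iff.1 h0 y (mem_univ y)
    refine le_trans (le_of_eq ?_) (hswap u)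
    simp [hz, h0]
  · have hAr : (A : ℝ) ≠ 0 := by positivity
    calc ∑ σ : V → W, treeWalkWeight T G σ * (I (σ u) * ∏ y, d (σ y) ^ (T.degree y - 1))
        ≤ ∑ σ : V → W, ∑ y, ((T.degree y - 1 : ℕ) : ℝ) / A *
            (treeWalkWeight T G σ * (I (σ u) * d (σ y) ^ A)) := by
          refine Finset.sum_le_sum fun σ _ => ?_
          have := prod_pow_le_sum_mul_pow (fun y => T.degree y - 1) (fun y => d (σ y))
            (fun y => Nat.cast_nonneg _) h0
          refine (mul_le_mul_of_nonneg_left (mul_le_mul_of_nonneg_left this (hI0 _))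
            (treeWalkWeight_nonneg T G σ)).trans (le_of_eq ?_)
          rw [Finset.mul_sum, Finset.mul_sum]
          exact Finset.sum_congr rfl fun y _ => by ring
      _ = ∑ y, ((T.degree y - 1 : ℕ) : ℝ) / A *
            ∑ σ : V → W, treeWalkWeight T G σ * (I (σ u) * d (σ y) ^ A) := by
          rw [Finset.sum_comm]
          simp only [Finset.mul_sum]
      _ ≤ ∑ y, ((T.degree y - 1 : ℕ) : ℝ) / A * ∑ v, d v * (I v * d v ^ A) :=
          Finset.sum_le_sum fun y _ => mul_le_mul_of_nonneg_left (hswap y) (by positivity)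
      _ = ∑ v, d v * (I v * d v ^ A) := by
          rw [← Finset.sum_mul, ← Finset.sum_div]
          have : (∑ y, ((T.degree y - 1 : ℕ) : ℝ)) = A := by rw [hA]; push_cast; rfl
          rw [this, div_self hAr, one_mul]

/-- Sandwich bound for the subgraph-rooted truncated estimator: for a non-empty
subgraph `O` of `H` (with vertex set `S`) and spanning tree `T` of `H`,
`emb(O,G) · E[X̄^O(ν*)] ≤ emb(H,G) ≤ emb(O,G) · E[X̄^O(ν*)] + i_T^O λ n`. -/
theorem subgraph_truncated_estimator_sandwich
    {VH VG : Type*} [Fintype VH] [Fintype VG]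
    (H : SimpleGraph VH) (G : SimpleGraph VG)
    (h n : ℕ) (hcard : Fintype.card VH = h) (hn : Fintype.card VG = n)
    (hconn : H.Connected)
    (T : SimpleGraph VH) (hTle : T ≤ H) (hTtree : T.IsTree)
    -- `O`: a non-empty subgraph of `H` with vertex set `S`
    (S : Finset VH) (hS : S.Nonempty)
    (O : SimpleGraph VH) (hOle : O ≤ H)
    (hOsupp : ∀ u v, O.Adj u v → u ∈ S ∧ v ∈ S)
    (Δ : ℕ) (hΔ : 0 < Δ) (lam : ℝ)
    (hexp : (∑ v : VG, if Δ ≤ G.degree v then (G.degree v : ℝ) ^ (h - 1) else 0) / n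
              ≤ lam)
    -- the set of embeddings of `O` into `G`
    (EmbO : Finset (S → VG))
    (hEmbO : EmbO = Finset.univ.filter
      (fun ν : S → VG =>
        (∀ u v : S, O.Adj u v → G.Adj (ν u) (ν v)) ∧ Function.Injective ν))
    (hEmbO1 : 1 ≤ EmbO.card)
    -- `X̄^O(ν)`: embeddings of `H` extending `ν`, truncated at the `O`-internal vertices
    (XO : (S → VG) → ℕ)
    (hXO : ∀ ν, XO ν = (Finset.univ.filter
      (fun σ : VH → VG =>
        (∀ a b, H.Adj a b → G.Adj (σ a) (σ b)) ∧ Function.Injective σ ∧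
        (∀ u : S, σ u = ν u) ∧
        ∀ u : VH,
          ((u ∉ S ∧ 2 ≤ T.degree u) ∨ (u ∈ S ∧ ∃ w, T.Adj u w ∧ w ∉ S)) →
            G.degree (σ u) < Δ)).card)
    -- `i_T^O`: number of `O`-internal vertices of `T`
    (iTO : ℕ)
    (hiTO : iTO = (Finset.univ.filter
      (fun u : VH =>
        (u ∉ S ∧ 2 ≤ T.degree u) ∨ (u ∈ S ∧ ∃ w, T.Adj u w ∧ w ∉ S))).card)
    -- `emb(H,G)`
    (emb : ℕ)
    (hemb : emb = (Finset.univ.filter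
      (fun σ : VH → VG =>
        (∀ a b, H.Adj a b → G.Adj (σ a) (σ b)) ∧ Function.Injective σ)).card) :
    (EmbO.card : ℝ) * ((∑ ν ∈ EmbO, (XO ν : ℝ)) / EmbO.card) ≤ (emb : ℝ) ∧
    (emb : ℝ) ≤ (EmbO.card : ℝ) * ((∑ ν ∈ EmbO, (XO ν : ℝ)) / EmbO.card)
                  + iTO * lam * n := by
  have hcardO : (EmbO.card : ℝ) ≠ 0 := by positivity
  rw [mul_div_cancel₀ _ hcardO]
  set P : VH → Prop := fun u =>
    (u ∉ S ∧ 2 ≤ T.degree u) ∨ (u ∈ S ∧ ∃ w, T.Adj u w ∧ w ∉ S) with hP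
  set E : Finset (VH → VG) := univ.filter fun σ : VH → VG =>
    (∀ a b, H.Adj a b → G.Adj (σ a) (σ b)) ∧ Function.Injective σ with hE
  set E' : Finset (VH → VG) := E.filter fun σ => ∀ u, P u → G.degree (σ u) < Δ with hE'
  have hsum : ∑ ν ∈ EmbO, (XO ν : ℝ) = (E'.card : ℝ) := by
    have hmaps : (E' : Set (VH → VG)).MapsTo (fun σ (u : S) => σ u) EmbO := by
      intro σ hσ
      simp only [hE', hE, coe_filter, mem_filter, mem_univ, true_and, Set.mem_ofPred_eq] at hσ
      simp only [hEmbO, coe_filter, mem_univ, true_and, Set.mem_ofPred_eq]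
      exact ⟨fun u v huv => hσ.1.1 _ _ (hOle huv), hσ.1.2.comp Subtype.val_injective⟩
    rw [Finset.card_eq_sum_card_fiberwise hmaps]
    push_cast
    refine Finset.sum_congr rfl fun ν _ => ?_
    rw [hXO]
    congr 2
    ext σ
    simp only [hE', hE, hP, mem_filter, mem_univ, true_and, funext_iff]
    tauto
  have hE'E : E'.card ≤ E.card := Finset.card_filter_le _ _
  rw [hsum, hemb]
  refine ⟨by exact_mod_cast hE'E, ?_⟩
  have hsplit : (E.card : ℝ) ≤ E'.card + ∑ u ∈ univ.filter P,
      ((univ.filter fun σ : VH → VG =>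
        (∀ a b, T.Adj a b → G.Adj (σ a) (σ b)) ∧ Δ ≤ G.degree (σ u)).card : ℝ) := by
    have hsub : E ⊆ E' ∪ (univ.filter P).biUnion fun u => univ.filter fun σ : VH → VG =>
        (∀ a b, T.Adj a b → G.Adj (σ a) (σ b)) ∧ Δ ≤ G.degree (σ u) := by
      intro σ hσ
      by_cases hgood : ∀ u, P u → G.degree (σ u) < Δ
      · exact Finset.mem_union_left _ (Finset.mem_filter.2 ⟨hσ, hgood⟩)
      · push Not at hgood
        obtain ⟨u, hu, hdu⟩ := hgood
        refine Finset.mem_union_right _ (Finset.mem_biUnion.2 ⟨u, by simpa using hu, ?_⟩)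
        simp only [mem_filter, mem_univ, true_and]
        exact ⟨fun a b hab => (Finset.mem_filter.1 hσ).2.1 _ _ (hTle hab), hdu⟩
    exact_mod_cast (Finset.card_le_card hsub).trans
      ((Finset.card_union_le _ _).trans (Nat.add_le_add_left Finset.card_biUnion_le _))
  have hbound : ∀ u ∈ univ.filter P,
      ((univ.filter fun σ : VH → VG =>
        (∀ a b, T.Adj a b → G.Adj (σ a) (σ b)) ∧ Δ ≤ G.degree (σ u)).card : ℝ) ≤ lam * n := by
    intro u hu
    have hV : 2 ≤ Fintype.card VH := by
      obtain ⟨w, hw⟩ : ∃ w, T.Adj u w := by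
        rcases (Finset.mem_filter.1 hu).2 with ⟨_, h2⟩ | ⟨_, w, hw, _⟩
        · exact (T.degree_pos_iff_exists_adj u).1 (by omega)
        · exact ⟨w, hw⟩
      exact Fintype.one_lt_card_iff.2 ⟨u, w, hw.ne⟩
    have hn0 : (0 : ℝ) < n := by
      obtain ⟨ν, -⟩ := Finset.card_pos.1 hEmbO1
      obtain ⟨s, hs⟩ := hS
      have : 0 < n := hn ▸ Fintype.card_pos_iff.2 ⟨ν ⟨s, hs⟩⟩
      exact_mod_cast this
    refine (card_tree_hom_truncated_le hTtree hV G Δ u).trans ?_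
    rw [hcard]
    exact (div_le_iff₀ hn0).1 hexp
  have htotal := Finset.sum_le_card_nsmul _ _ _ hbound
  rw [nsmul_eq_mul, ← hiTO] at htotal
  linarith
end
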